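/- Let K, t be integers with t ≥ 1 and 2t ≤ K, and set γ_p = t − 1. Then the number of subsets I of ZMod K with |I| = 2t that contain at least one cyclic interval of length t equals C(K−t, t) + (K−1)·C(K−t−1, t) − ((K−2t)(K−2t+1)/2)⁺ − ((t−1)(K−2t−1))⁺ − Σ_{i=1}^{t−1} C(K−2t−1+i, i), where C(n,k) denotes the binomial coefficient with the convention C(n,k) = 0 whenever n < 0, k < 0, or n < k, and x⁺ = max(0,x). -/

import Mathlib

/-- The cyclic interval `{i, i+1, ..., i+m−1}` (addition modulo `K`) in `ZMod K`. -/
def cycInterval (K m : ℕ) (i : ZMod K) : Finset (ZMod K) :=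
  (Finset.range m).image (fun j : ℕ => (i + (j : ZMod K)))

/-- `S` is a cyclic interval of length `m` in `ZMod K`. -/
def IsCycInterval (K m : ℕ) (S : Finset (ZMod K)) : Prop :=
  ∃ i : ZMod K, S = cycInterval K m i

/-- Binomial coefficient on integers with the convention `C(n,k) = 0` whenever
`n < 0`, `k < 0`, or `n < k`. -/
def binomZ (n k : ℤ) : ℤ :=
  if 0 ≤ n ∧ 0 ≤ k ∧ k ≤ n then n.toNat.choose k.toNat else 0

open Finset

lemma mem_cycInterval {K m : ℕ} {i x : ZMod K} :
    x ∈ cycInterval K m i ↔ ∃ a < m, i + (a : ZMod K) = x := by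
  simp [cycInterval]

lemma natCast_zmod_inj {K a b : ℕ} (ha : a < K) (hb : b < K)
    (h : (a : ZMod K) = (b : ZMod K)) : a = b := by
  rw [ZMod.natCast_eq_natCast_iff'] at h
  rwa [Nat.mod_eq_of_lt ha, Nat.mod_eq_of_lt hb] at h

lemma card_cycInterval {K m : ℕ} (h : m ≤ K) (i : ZMod K) : #(cycInterval K m i) = m := by
  rw [cycInterval, card_image_of_injOn, card_range]
  intro a ha b hb hab
  simp only [coe_range, Set.mem_Iio] at ha hb
  exact natCast_zmod_inj (ha.trans_le h) (hb.trans_le h) (add_left_cancel hab)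

/-- A run of length at least `t` of `I` starts at `i`. -/
def IsRunStart (K t : ℕ) (I : Finset (ZMod K)) (i : ZMod K) : Prop :=
  i - 1 ∉ I ∧ cycInterval K t i ⊆ I

lemma pred_notMem_cycInterval {K t : ℕ} (h : t < K) (i : ZMod K) :
    i - 1 ∉ cycInterval K t i := by
  rw [mem_cycInterval]
  rintro ⟨a, ha, hx⟩
  have h1 : ((a + 1 : ℕ) : ZMod K) = ((0 : ℕ) : ZMod K) := by
    push_cast
    linear_combination hx
  have := natCast_zmod_inj (by lia) (by lia) h1
  lia

lemma IsRunStart.eq_of_add_eq {K t a b : ℕ} {I : Finset (ZMod K)} {i j : ZMod K}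
    (hi : IsRunStart K t I i) (hj : IsRunStart K t I j) (ha : a ≤ t) (hba : b ≤ a)
    (h : i + (a : ZMod K) = j + (b : ZMod K)) : i = j := by
  obtain ⟨d, rfl⟩ := Nat.exists_eq_add_of_le hba
  rcases d with _ | d
  · simpa using h
  · refine absurd (hi.2 (mem_cycInterval.2 ⟨d, by lia, ?_⟩)) hj.1
    push_cast at h
    linear_combination h

lemma IsRunStart.disjoint {K t : ℕ} {I : Finset (ZMod K)} {i j : ZMod K}
    (hi : IsRunStart K t I i) (hj : IsRunStart K t I j) (hij : i ≠ j) :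
    Disjoint (cycInterval K t i) (cycInterval K t j) := by
  rw [Finset.disjoint_left]
  intro x hx hy
  obtain ⟨a, ha, rfl⟩ := mem_cycInterval.1 hx
  obtain ⟨b, hb, h⟩ := mem_cycInterval.1 hy
  rcases le_total b a with hab | hab
  · exact hij (hi.eq_of_add_eq hj ha.le hab h.symm)
  · exact hij (hj.eq_of_add_eq hi hb.le hab h).symm

lemma exists_isRunStart {K t : ℕ} [NeZero K] {I : Finset (ZMod K)} (hI : #I < K) {k : ZMod K}
    (hk : cycInterval K t k ⊆ I) : ∃ i, IsRunStart K t I i := by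
  classical
  have hex : ∃ a : ℕ, k - 1 - (a : ZMod K) ∉ I := by
    obtain ⟨x, hx⟩ : ∃ x, x ∉ I := by
      by_contra! h
      rw [eq_univ_of_forall h, card_univ, ZMod.card] at hI
      exact lt_irrefl _ hI
    exact ⟨(k - 1 - x).val, by simpa using hx⟩
  refine ⟨k - (Nat.find hex : ZMod K), ?_, fun x hx => ?_⟩
  · rw [sub_right_comm]
    exact Nat.find_spec hex
  · obtain ⟨j, hj, rfl⟩ := mem_cycInterval.1 hx
    rcases lt_or_ge j (Nat.find hex) with h | h
    · obtain ⟨d, hd⟩ := Nat.exists_eq_add_of_lt h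
      have := not_not.1 (Nat.find_min hex (m := d) (by lia))
      convert this using 1
      rw [hd]
      push_cast
      ring
    · obtain ⟨d, hd⟩ := Nat.exists_eq_add_of_le h
      refine hk (mem_cycInterval.2 ⟨d, by lia, ?_⟩)
      rw [hd]
      push_cast
      ring

open Classical in
lemma card_filter_isRunStart {K t : ℕ} [NeZero K] (hK : 2 * t < K) (i : ZMod K) :
    #{I ∈ powersetCard (2 * t) (univ : Finset (ZMod K)) | IsRunStart K t I i} =
      (K - t - 1).choose t := by
  have hc := card_cycInterval (m := t) (K := K) (by lia) i
  have hp := pred_notMem_cycInterval (K := K) (t := t) (by lia) i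
  have hcard : #((insert (i - 1) (cycInterval K t i))ᶜ) = K - t - 1 := by
    rw [card_compl, card_insert_of_notMem hp, hc, ZMod.card]
    lia
  rw [← hcard, ← card_powersetCard]
  refine card_nbij' (· \ cycInterval K t i) (· ∪ cycInterval K t i) ?_ ?_ ?_ ?_
  · intro I hI
    simp only [coe_filter, mem_powersetCard, Set.mem_ofPred_eq, subset_univ, true_and] at hI
    obtain ⟨h1, h2, h3⟩ := hI
    simp only [mem_coe, mem_powersetCard]
    refine ⟨fun x hx => ?_, ?_⟩
    · rw [mem_sdiff] at hx
      rw [mem_compl, mem_insert]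
      rintro (rfl | h)
      exacts [h2 hx.1, hx.2 h]
    · rw [card_sdiff_of_subset h3]
      lia
  · intro I hI
    simp only [mem_coe, mem_powersetCard] at hI
    have hx : ∀ x ∈ I, x ≠ i - 1 ∧ x ∉ cycInterval K t i := by
      simpa [subset_iff] using hI.1
    have hd : Disjoint I (cycInterval K t i) := Finset.disjoint_left.2 fun x h => (hx x h).2
    simp only [coe_filter, mem_powersetCard, Set.mem_ofPred_eq, subset_univ, true_and]
    refine ⟨by rw [card_union_of_disjoint hd]; lia, ?_, subset_union_right⟩
    rw [mem_union]
    rintro (h | h)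
    exacts [(hx _ h).1 rfl, hp h]
  · intro I hI
    simp only [coe_filter, Set.mem_ofPred_eq] at hI
    exact sdiff_union_of_subset hI.2.2
  · intro I hI
    simp only [mem_coe, mem_powersetCard] at hI
    refine union_sdiff_cancel_right (Finset.disjoint_left.2 fun x h h' => ?_)
    have := hI.1 h
    simp [h'] at this

open Classical in
lemma card_filter_isRunStart_pair {K t : ℕ} [NeZero K] (ht : 1 ≤ t) (hK : 2 * t < K)
    {i j : ZMod K} (hij : i ≠ j) :
    #{I ∈ powersetCard (2 * t) (univ : Finset (ZMod K)) | IsRunStart K t I i ∧ IsRunStart K t I j}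
      = if (j - i).val ∈ Ico (t + 1) (K - t) then 1 else 0 := by
  have hci := card_cycInterval (m := t) (K := K) (by lia) i
  have hcj := card_cycInterval (m := t) (K := K) (by lia) j
  obtain ⟨d, hdK, hd, rfl⟩ : ∃ d < K, (j - i).val = d ∧ j = i + (d : ZMod K) :=
    ⟨_, ZMod.val_lt _, rfl, by simp⟩
  rw [hd]
  have hKz : (K : ZMod K) = 0 := ZMod.natCast_self K
  have hd0 : d ≠ 0 := by
    rintro rfl
    simp at hij
  split_ifs with h
  · rw [mem_Ico] at h
    have hpj : i + (d : ZMod K) - 1 ∉ cycInterval K t i := by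
      rw [mem_cycInterval]
      rintro ⟨a, ha, hx⟩
      have : ((a + 1 : ℕ) : ZMod K) = (d : ℕ) := by
        push_cast
        linear_combination hx
      have := natCast_zmod_inj (by lia) (by lia) this
      lia
    have hpi : i - 1 ∉ cycInterval K t (i + (d : ZMod K)) := by
      rw [mem_cycInterval]
      rintro ⟨a, ha, hx⟩
      have : ((d + a + 1 : ℕ) : ZMod K) = (0 : ℕ) := by
        push_cast
        linear_combination hx
      have := natCast_zmod_inj (by lia) (by lia) this
      lia
    have hdisj : Disjoint (cycInterval K t i) (cycInterval K t (i + (d : ZMod K))) := by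
      rw [Finset.disjoint_left]
      intro x hx hy
      obtain ⟨a, ha, rfl⟩ := mem_cycInterval.1 hx
      obtain ⟨b, hb, h'⟩ := mem_cycInterval.1 hy
      have : ((d + b : ℕ) : ZMod K) = (a : ℕ) := by
        push_cast
        linear_combination h'
      have := natCast_zmod_inj (by lia) (by lia) this
      lia
    rw [card_eq_one]
    refine ⟨cycInterval K t i ∪ cycInterval K t (i + (d : ZMod K)), ?_⟩
    ext I
    simp only [mem_filter, mem_powersetCard, subset_univ, true_and, mem_singleton]
    constructor
    · rintro ⟨hc, hi, hj⟩
      refine (eq_of_subset_of_card_le (union_subset hi.2 hj.2) ?_).symm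
      rw [card_union_of_disjoint hdisj]
      lia
    · rintro rfl
      refine ⟨by rw [card_union_of_disjoint hdisj]; lia, ⟨?_, subset_union_left⟩,
        ⟨?_, subset_union_right⟩⟩
      · rw [mem_union]
        exact not_or.2 ⟨pred_notMem_cycInterval (by lia) _, hpi⟩
      · rw [mem_union]
        exact not_or.2 ⟨hpj, pred_notMem_cycInterval (by lia) _⟩
  · rw [card_eq_zero, filter_eq_empty_iff]
    rintro I - ⟨hi, hj⟩
    rw [mem_Ico, not_and_or, not_le, not_lt] at h
    rcases h with h | h
    · exact hij (hi.eq_of_add_eq hj (a := d) (b := 0) (by lia) (by lia) (by simp))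
    · refine hij (hj.eq_of_add_eq hi (a := K - d) (b := 0) (by lia) (by lia) ?_).symm
      rw [Nat.cast_sub hdK.le, hKz]
      simp

lemma card_filter_val_sub {K t : ℕ} [NeZero K] (i : ZMod K) :
    #{j : ZMod K | (j - i).val ∈ Ico (t + 1) (K - t)} = K - 2 * t - 1 := by
  have : K - 2 * t - 1 = #(Ico (t + 1) (K - t)) := by
    rw [Nat.card_Ico]
    lia
  rw [this]
  refine card_nbij' (fun j => (j - i).val) (fun d => i + (d : ZMod K)) ?_ ?_ ?_ ?_
  · intro j hj
    simpa using hj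
  · intro d hd
    have hd' : t + 1 ≤ d ∧ d < K - t := by simpa using hd
    have : d % K = d := Nat.mod_eq_of_lt (by lia)
    simpa [ZMod.val_natCast, this] using hd'
  · intro j _
    simp
  · intro d hd
    have hd' : t + 1 ≤ d ∧ d < K - t := by simpa using hd
    have : d % K = d := Nat.mod_eq_of_lt (by lia)
    simp [ZMod.val_natCast, this]

open Classical in
lemma card_runStarts_le_two {K t : ℕ} [NeZero K] (ht : 1 ≤ t) (hK : 2 * t < K)
    {I : Finset (ZMod K)} (hI : #I = 2 * t) : #{i | IsRunStart K t I i} ≤ 2 := by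
  have h := card_biUnion (s := {i | IsRunStart K t I i}) (t := cycInterval K t)
    (fun i hi j hj hij => (mem_filter.1 hi).2.disjoint (mem_filter.1 hj).2 hij)
  rw [sum_congr rfl fun i _ => card_cycInterval (by lia) i, sum_const, smul_eq_mul] at h
  have h2 : #(({i | IsRunStart K t I i} : Finset (ZMod K)).biUnion (cycInterval K t)) ≤ #I :=
    card_le_card (biUnion_subset.2 fun i hi => (mem_filter.1 hi).2.2)
  rw [h, hI] at h2
  exact Nat.le_of_mul_le_mul_right h2 ht

open Classical in
lemma two_mul_card_add {K t : ℕ} [NeZero K] (ht : 1 ≤ t) (hK : 2 * t < K) :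
    2 * {I : Finset (ZMod K) | #I = 2 * t ∧ ∃ S ⊆ I, IsCycInterval K t S}.ncard
      + K * (K - 2 * t - 1) = 2 * (K * (K - t - 1).choose t) := by
  set P := powersetCard (2 * t) (univ : Finset (ZMod K)) with hP
  have hset : {I : Finset (ZMod K) | #I = 2 * t ∧ ∃ S ⊆ I, IsCycInterval K t S} =
      (({I ∈ P | ∃ i, IsRunStart K t I i} : Finset (Finset (ZMod K))) : Set _) := by
    ext I
    simp only [Set.mem_ofPred_eq, coe_filter, hP, mem_powersetCard, subset_univ, true_and]
    refine and_congr_right fun hI => ⟨?_, ?_⟩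
    · rintro ⟨S, hS, k, rfl⟩
      exact exists_isRunStart (by lia) hS
    · rintro ⟨i, hi⟩
      exact ⟨_, hi.2, i, rfl⟩
  have hsingle : ∑ I ∈ P, #{i | IsRunStart K t I i} = K * (K - t - 1).choose t := by
    simp_rw [card_filter _ (univ : Finset (ZMod K))]
    rw [sum_comm]
    simp_rw [← card_filter, hP, card_filter_isRunStart hK]
    simp
  have hpair : ∑ I ∈ P, #({i | IsRunStart K t I i} : Finset (ZMod K)).offDiag =
      K * (K - 2 * t - 1) := by
    have h1 (I : Finset (ZMod K)) : #({i | IsRunStart K t I i} : Finset (ZMod K)).offDiag =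
        ∑ i : ZMod K, ∑ j : ZMod K,
          if i ≠ j ∧ IsRunStart K t I i ∧ IsRunStart K t I j then 1 else 0 := by
      rw [← Fintype.sum_prod_type', ← card_filter]
      congr 1
      ext ⟨i, j⟩
      simp
      tauto
    simp_rw [h1]
    have h2 (i : ZMod K) : ∑ I ∈ P, ∑ j : ZMod K,
        (if i ≠ j ∧ IsRunStart K t I i ∧ IsRunStart K t I j then 1 else 0) =
          K - 2 * t - 1 := by
      rw [sum_comm, ← card_filter_val_sub i, card_filter]
      refine sum_congr rfl fun j _ => ?_
      by_cases hij : i = j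
      · subst hij
        simp
      · rw [← card_filter_isRunStart_pair ht hK hij, card_filter]
        simp [hij, hP]
    rw [sum_comm, sum_congr rfl fun i _ => h2 i]
    simp
  rw [hset, Set.ncard_coe_finset, ← hsingle, ← hpair, card_filter, mul_sum, mul_sum,
    ← sum_add_distrib]
  refine sum_congr rfl fun I hI => ?_
  have h2 := card_runStarts_le_two ht hK (mem_powersetCard.1 hI).2
  have hpos : (∃ i, IsRunStart K t I i) ↔ 0 < #{i | IsRunStart K t I i} := by
    simp [card_pos, Finset.Nonempty]
  rw [offDiag_card, if_congr hpos rfl rfl]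
  generalize #{i | IsRunStart K t I i} = r at h2
  interval_cases r <;> rfl

lemma binomZ_natCast (n k : ℕ) : binomZ n k = n.choose k := by
  rw [binomZ]
  split_ifs with h
  · simp
  · rw [Nat.choose_eq_zero_of_lt (by lia)]
    rfl

lemma sum_Icc_choose_add_one (m s : ℕ) :
    ∑ i ∈ Icc 1 s, (m + i).choose i + 1 = (m + s + 1).choose s := by
  induction s with
  | zero => simp
  | succ s ih =>
    rw [sum_Icc_succ_top (by lia), add_right_comm, ih, ← add_assoc m s 1,
      ← Nat.choose_succ_succ']

lemma ncard_of_eq_two_mul {K t : ℕ} (ht : 1 ≤ t) (hK : K = 2 * t) :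
    {I : Finset (ZMod K) | #I = 2 * t ∧ ∃ S ⊆ I, IsCycInterval K t S}.ncard = 1 := by
  have : NeZero K := ⟨by lia⟩
  rw [Set.ncard_eq_one]
  refine ⟨univ, ?_⟩
  ext I
  simp only [Set.mem_ofPred_eq, Set.mem_singleton_iff]
  constructor
  · rintro ⟨h, -⟩
    rw [← card_eq_iff_eq_univ, h, ZMod.card, hK]
  · rintro rfl
    exact ⟨by rw [card_univ, ZMod.card, hK], _, subset_univ _, 0, rfl⟩

/-- **Total number of transmission-subsets, regime `γ_p = t − 1`.**
For `t ≥ 1` and `2t ≤ K`, the number of subsets `I` of `ZMod K` with `|I| = 2t`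
containing at least one cyclic interval of length `t` equals
`C(K−t, t) + (K−1)·C(K−t−1, t) − ((K−2t)(K−2t+1)/2)⁺ − ((t−1)(K−2t−1))⁺
  − Σ_{i=1}^{t−1} C(K−2t−1+i, i)`. -/
theorem count_transmission_subsets_boundary
    (K t : ℕ) (ht : 1 ≤ t) (hK : 2 * t ≤ K) :
    ({I : Finset (ZMod K) | I.card = 2 * t ∧
        ∃ S ⊆ I, IsCycInterval K t S}.ncard : ℤ) =
      binomZ ((K : ℤ) - t) t + ((K : ℤ) - 1) * binomZ ((K : ℤ) - t - 1) t
        - max 0 (((K : ℤ) - 2 * t) * ((K : ℤ) - 2 * t + 1) / 2)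
        - max 0 (((t : ℤ) - 1) * ((K : ℤ) - 2 * t - 1))
        - ∑ i ∈ Finset.Icc 1 (t - 1), binomZ ((K : ℤ) - 2 * t - 1 + i) i := by
  rcases hK.eq_or_lt with h | h
  · rw [ncard_of_eq_two_mul ht h.symm]
    have hKt : (K : ℤ) = 2 * t := by exact_mod_cast h.symm
    have hsum : ∑ i ∈ Icc 1 (t - 1), binomZ ((K : ℤ) - 2 * t - 1 + i) i = 0 := by
      refine sum_eq_zero fun i _ => ?_
      rw [binomZ, if_neg (by lia)]
    have h1 : (K : ℤ) - t = (t : ℕ) := by lia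
    have h2 : binomZ ((K : ℤ) - t - 1) t = 0 := by
      rw [binomZ, if_neg (by lia)]
    have h3 : ((t : ℤ) - 1) * ((K : ℤ) - 2 * t - 1) ≤ 0 := by
      rw [hKt]
      linarith [(by exact_mod_cast ht : (1 : ℤ) ≤ t)]
    rw [hsum, h2, h1, binomZ_natCast, max_eq_left h3, hKt]
    simp
  · have : NeZero K := ⟨by lia⟩
    have hcount := two_mul_card_add ht h
    obtain ⟨m, rfl⟩ : ∃ m, K = 2 * t + m + 1 := Nat.exists_eq_add_of_lt h
    obtain ⟨s, rfl⟩ : ∃ s, t = s + 1 := ⟨t - 1, by lia⟩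
    generalize Set.ncard _ = N at hcount ⊢
    rw [show 2 * (s + 1) + m + 1 - 2 * (s + 1) - 1 = m by lia,
      show 2 * (s + 1) + m + 1 - (s + 1) - 1 = m + s + 1 by lia] at hcount
    have e1 : ((2 * (s + 1) + m + 1 : ℕ) : ℤ) - (s + 1 : ℕ) = (m + s + 1 + 1 : ℕ) := by
      push_cast
      ring
    have e2 : ((m + s + 1 + 1 : ℕ) : ℤ) - 1 = (m + s + 1 : ℕ) := by
      push_cast
      ring
    have e3 : ((2 * (s + 1) + m + 1 : ℕ) : ℤ) - 2 * (s + 1 : ℕ) = (m : ℤ) + 1 := by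
      push_cast
      ring
    have hsum := sum_Icc_choose_add_one m s
    have e4 : ∑ i ∈ Icc 1 (s + 1 - 1), binomZ ((m : ℤ) + 1 - 1 + i) i =
        (m + s + 1).choose s - 1 := by
      rw [← hsum, Nat.add_sub_cancel, Nat.cast_add, Nat.cast_one, Nat.cast_sum]
      simp only [add_sub_cancel_right]
      refine sum_congr rfl fun i _ => ?_
      rw [← Nat.cast_add, binomZ_natCast]
    obtain ⟨q, hq⟩ : (2 : ℤ) ∣ ((m : ℤ) + 1) * ((m : ℤ) + 1 + 1) :=
      (Int.even_mul_succ_self _).two_dvd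
    have hq0 : 0 ≤ q := by
      have : (0 : ℤ) ≤ ((m : ℤ) + 1) * ((m : ℤ) + 1 + 1) := by positivity
      lia
    have e5 : (0 : ℤ) ≤ (((s + 1 : ℕ) : ℤ) - 1) * ((m : ℤ) + 1 - 1) := by
      push_cast
      simp only [add_sub_cancel_right]
      positivity
    rw [e1, e2, e3, e4, binomZ_natCast, binomZ_natCast, max_eq_right e5, hq,
      Int.mul_ediv_cancel_left _ two_ne_zero, max_eq_right hq0, Nat.choose_succ_succ']
    have hc : 2 * (N : ℤ) + (2 * (s + 1) + m + 1) * m =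
        2 * ((2 * (s + 1) + m + 1) * (m + s + 1).choose (s + 1)) := by
      exact_mod_cast hcount
    push_cast
    refine mul_left_cancel₀ (two_ne_zero (α := ℤ)) ?_
    linear_combination hc - hq
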